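/- Suppose U : (0,∞) → [0,∞) satisfies U(x) ∼ c x^ρ ℓ(1/x)/Γ(1+ρ) as x → 0, where c ≥ 0, ρ > −1, ℓ is slowly varying at infinity, and Û(s) = s ∫_0^∞ e^{−sx} U(x) dx converges for all s > 0. Then Û(s) ∼ c s^{−ρ} ℓ(s) as s → ∞. -/

import Mathlib

open Real Filter MeasureTheory Set

/-- ℓ is slowly varying at infinity: ℓ(kx)/ℓ(x) → 1 as x → ∞ for every k > 0. -/
def SlowlyVaryingAtTop (ℓ : ℝ → ℝ) : Prop :=
  ∀ k : ℝ, 0 < k → Filter.Tendsto (fun x => ℓ (k * x) / ℓ x) Filter.atTop (nhds 1)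

open scoped Topology

theorem aemeasurable_comp_mul_right {h : ℝ → ℝ} (hm : AEMeasurable h (volume.restrict (Ioi 0)))
    {x : ℝ} (hx : 0 < x) : AEMeasurable (fun v => h (v * x)) (volume.restrict (Ioi 0)) := by
  refine hm.comp_quasiMeasurePreserving ⟨by fun_prop, ?_⟩
  have hpre : Ioi (0 : ℝ) = (fun v => v * x) ⁻¹' Ioi 0 := by
    ext v; simp [hx]
  conv_lhs => rw [hpre]
  rw [← Measure.restrict_map (by fun_prop) measurableSet_Ioi, Real.map_volume_mul_right hx.ne',
    Measure.restrict_smul]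
  exact Measure.smul_absolutelyContinuous

theorem intervalIntegrable_min_one_abs_sub {h : ℝ → ℝ}
    (hm : AEMeasurable h (volume.restrict (Ioi 0))) {x a b : ℝ} (hx : 0 < x) (ha : 0 < a)
    (hab : a ≤ b) (z : ℝ) :
    IntervalIntegrable (fun v => min 1 |h (v * x) - z|) volume a b := by
  rw [intervalIntegrable_iff_integrableOn_Ioc_of_le hab]
  have hmeas : AEMeasurable (fun v => min 1 |h (v * x) - z|) (volume.restrict (Ioc a b)) := by
    have h1 := (aemeasurable_comp_mul_right hm hx).mono_measure
      (Measure.restrict_mono (show Ioc a b ⊆ Ioi 0 from fun v hv => ha.trans hv.1) le_rfl)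
    exact aemeasurable_const.min ((h1.sub_const z).abs)
  refine Integrable.mono' (integrable_const (1 : ℝ)) hmeas.aestronglyMeasurable
    (ae_of_all _ fun v => ?_)
  rw [Real.norm_eq_abs, abs_of_nonneg (le_min zero_le_one (abs_nonneg _))]
  exact min_le_left _ _

theorem tendsto_integral_min_one_abs_sub {h : ℝ → ℝ}
    (hm : AEMeasurable h (volume.restrict (Ioi 0)))
    (hlim : ∀ k : ℝ, 0 < k → Tendsto (fun x => h (k * x) - h x) (𝓝[>] 0) (𝓝 0)) :
    Tendsto (fun x => ∫ v in (1 : ℝ)..3, min 1 |h (v * x) - h x|) (𝓝[>] 0) (𝓝 0) := by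
  have key := intervalIntegral.tendsto_integral_filter_of_dominated_convergence
    (μ := volume) (a := 1) (b := 3) (l := 𝓝[>] (0 : ℝ))
    (F := fun x v => min 1 |h (v * x) - h x|) (f := fun _ => (0 : ℝ)) (fun _ => (1 : ℝ)) ?_ ?_ ?_ ?_
  · simpa using key
  · filter_upwards [self_mem_nhdsWithin] with x hx
    rw [uIoc_of_le (by norm_num)]
    exact (intervalIntegrable_min_one_abs_sub hm hx one_pos (by norm_num) _).1.aestronglyMeasurable
  · refine Eventually.of_forall fun x => ae_of_all _ fun v _ => ?_
    rw [Real.norm_eq_abs, abs_of_nonneg (le_min zero_le_one (abs_nonneg _))]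
    exact min_le_left _ _
  · simp
  · refine ae_of_all _ fun v hv => ?_
    rw [uIoc_of_le (by norm_num)] at hv
    have := (tendsto_const_nhds (x := (1 : ℝ))).min (hlim v (one_pos.trans hv.1)).abs
    simpa using this

/-- Uniform convergence theorem for (additive) slow variation at `0`. -/
theorem exists_abs_sub_le_of_slowlyVarying {h : ℝ → ℝ}
    (hm : AEMeasurable h (volume.restrict (Ioi 0)))
    (hlim : ∀ k : ℝ, 0 < k → Tendsto (fun x => h (k * x) - h x) (𝓝[>] 0) (𝓝 0))
    {ε : ℝ} (hε : 0 < ε) :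
    ∃ δ > 0, ∀ x k : ℝ, 0 < x → 1 ≤ k → k ≤ 2 → k * x < δ → |h (k * x) - h x| ≤ ε := by
  set F : ℝ → ℝ := fun x => ∫ v in (1 : ℝ)..3, min 1 |h (v * x) - h x|
  have hη : 0 < min 1 ε / 4 := by positivity
  obtain ⟨δ, hδ, hball⟩ := mem_nhdsGT_iff_exists_Ioo_subset.1
    ((tendsto_integral_min_one_abs_sub hm hlim).eventually (gt_mem_nhds hη))
  refine ⟨δ, hδ, fun x k hx hk1 hk2 hkx => ?_⟩
  have hk0 : 0 < k := by linarith
  have hkx0 : 0 < k * x := by positivity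
  have hxδ : x < δ := lt_of_le_of_lt (by nlinarith) hkx
  have hF1 : F x < min 1 ε / 4 := hball ⟨hx, hxδ⟩
  have hF2 : F (k * x) < min 1 ε / 4 := hball ⟨hkx0, hkx⟩
  have hI1 := intervalIntegrable_min_one_abs_sub hm hx one_pos (by norm_num : (1 : ℝ) ≤ 3) (h x)
  have hI1' := intervalIntegrable_min_one_abs_sub hm hx two_pos (by norm_num : (2 : ℝ) ≤ 3) (h x)
  have hI2 := intervalIntegrable_min_one_abs_sub hm hx two_pos (by norm_num : (2 : ℝ) ≤ 3)
    (h (k * x))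
  have hI3 := intervalIntegrable_min_one_abs_sub hm hkx0 one_pos (by norm_num : (1 : ℝ) ≤ 3)
    (h (k * x))
  have hnn : ∀ y z : ℝ, 0 ≤ᵐ[volume.restrict (Ioc (1 : ℝ) 3)] fun v => min 1 |h (v * y) - z| :=
    fun y z => ae_of_all _ fun v => le_min zero_le_one (abs_nonneg _)
  have e1 : ∫ v in (2 : ℝ)..3, min 1 |h (v * x) - h x| ≤ F x :=
    intervalIntegral.integral_mono_interval (by norm_num) (by norm_num) le_rfl (hnn _ _) hI1
  have e2 : ∫ v in (2 : ℝ)..3, min 1 |h (v * x) - h (k * x)| ≤ k * F (k * x) := by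
    have hsub : ∫ v in (2 : ℝ)..3, min 1 |h (v * x) - h (k * x)|
        = k * ∫ w in (2 / k)..(3 / k), min 1 |h (w * (k * x)) - h (k * x)| := by
      have hdiv := intervalIntegral.integral_comp_div (a := 2) (b := 3)
        (fun w => min 1 |h (w * (k * x)) - h (k * x)|) hk0.ne'
      rw [smul_eq_mul] at hdiv
      rw [← hdiv]
      congr 1
      ext v
      rw [show v / k * (k * x) = v * x by field_simp]
    rw [hsub]
    refine mul_le_mul_of_nonneg_left ?_ hk0.le
    refine intervalIntegral.integral_mono_interval ?_ ?_ ?_ (hnn _ _) hI3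
    · rw [le_div_iff₀ hk0]; linarith
    · gcongr; norm_num
    · rw [div_le_iff₀ hk0]; linarith
  have e3 : min 1 |h (k * x) - h x| ≤
      ∫ v in (2 : ℝ)..3, (min 1 |h (v * x) - h x| + min 1 |h (v * x) - h (k * x)|) := by
    have : ∫ v in (2 : ℝ)..3, min 1 |h (k * x) - h x| = min 1 |h (k * x) - h x| := by
      rw [intervalIntegral.integral_const, smul_eq_mul]; norm_num
    rw [← this]
    refine intervalIntegral.integral_mono_on (by norm_num) (by simp) (hI1'.add hI2) fun v _ => ?_
    have ht := abs_sub_le (h (k * x)) (h (v * x)) (h x)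
    rw [abs_sub_comm (h (k * x)) (h (v * x))] at ht
    have := abs_nonneg (h (v * x) - h x)
    have := abs_nonneg (h (v * x) - h (k * x))
    rcases min_cases 1 |h (k * x) - h x| with h1 | h1 <;>
    rcases min_cases 1 |h (v * x) - h x| with h2 | h2 <;>
    rcases min_cases 1 |h (v * x) - h (k * x)| with h3 | h3 <;> linarith
  rw [intervalIntegral.integral_add hI1' hI2] at e3
  have hlt : min 1 |h (k * x) - h x| < min 1 ε := by
    nlinarith
  rcases min_cases 1 |h (k * x) - h x| with h1 | h1
  · have := min_le_left 1 ε
    linarith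
  · have := min_le_right 1 ε
    linarith

/-- Potter bounds for (additive) slow variation at `0`. -/
theorem exists_abs_sub_le_mul_log_of_slowlyVarying {h : ℝ → ℝ}
    (hm : AEMeasurable h (volume.restrict (Ioi 0)))
    (hlim : ∀ k : ℝ, 0 < k → Tendsto (fun x => h (k * x) - h x) (𝓝[>] 0) (𝓝 0))
    {ε : ℝ} (hε : 0 < ε) :
    ∃ δ > 0, ∀ x z : ℝ, 0 < x → x < δ → 0 < z → z < δ →
      |h z - h x| ≤ ε * (|log (z / x)| + 1) := by
  have hlog2 : 0 < log 2 := log_pos one_lt_two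
  have hlog2' : log 2 ≤ 1 := by linarith [log_two_lt_d9]
  obtain ⟨δ, hδ, hunif⟩ := exists_abs_sub_le_of_slowlyVarying hm hlim (mul_pos hε hlog2)
  have hpow : ∀ n : ℕ, ∀ x z : ℝ, 0 < x → x ≤ z → z < δ → z ≤ 2 ^ n * x →
      |h z - h x| ≤ ε * log 2 * n := by
    intro n
    induction n with
    | zero =>
      intro x z hx hxz _ hz
      have : z = x := le_antisymm (by simpa using hz) hxz
      simp [this]
    | succ n ih =>
      intro x z hx hxz hzδ hz
      have hn : (0 : ℝ) ≤ n := n.cast_nonneg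
      have hpos := mul_pos hε hlog2
      push_cast
      by_cases hz2 : z ≤ 2 * x
      · have h1 := hunif x (z / x) hx ((one_le_div hx).2 hxz) ((div_le_iff₀ hx).2 hz2)
          (by rwa [div_mul_cancel₀ _ hx.ne'])
        rw [div_mul_cancel₀ _ hx.ne'] at h1
        nlinarith
      · push Not at hz2
        have h1 := ih x (z / 2) hx (by linarith) (by linarith) (by rw [pow_succ] at hz; linarith)
        have h2 := hunif (z / 2) 2 (by linarith) one_le_two le_rfl (by linarith)
        rw [mul_div_cancel₀ z two_ne_zero] at h2
        have := abs_sub_le (h z) (h (z / 2)) (h x)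
        linarith
  have hle : ∀ x z : ℝ, 0 < x → x ≤ z → z < δ → |h z - h x| ≤ ε * (|log (z / x)| + 1) := by
    intro x z hx hxz hzδ
    have hq : 1 ≤ z / x := (one_le_div hx).2 hxz
    have hl : 0 ≤ log (z / x) := log_nonneg hq
    set n := ⌈log (z / x) / log 2⌉₊
    have hn1 : log (z / x) / log 2 ≤ n := Nat.le_ceil _
    have hn2 : (n : ℝ) < log (z / x) / log 2 + 1 := Nat.ceil_lt_add_one (by positivity)
    have hz : z ≤ 2 ^ n * x := by
      rw [← div_le_iff₀ hx, ← log_le_log_iff (by linarith) (by positivity), log_pow]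
      exact (div_le_iff₀ hlog2).1 hn1
    have h1 := hpow n x z hx hxz hzδ hz
    rw [abs_of_nonneg hl]
    calc |h z - h x| ≤ ε * (log 2 * n) := by linarith
      _ ≤ ε * (log (z / x) + 1) := by
        gcongr
        calc log 2 * n ≤ log 2 * (log (z / x) / log 2 + 1) := by gcongr
          _ = log (z / x) + log 2 := by field_simp
          _ ≤ _ := by linarith
  refine ⟨δ, hδ, fun x z hx hxδ hz hzδ => ?_⟩
  rcases le_total x z with hxz | hzx
  · exact hle x z hx hxz hzδ
  · have := hle z x hz hzx hxδ
    rwa [abs_sub_comm, ← inv_div, log_inv, abs_neg] at this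

/-- Potter bounds for a function regularly varying at `0` with index `ρ`. -/
theorem potter_bound_of_regularlyVarying {U : ℝ → ℝ} {ρ : ℝ}
    (hm : AEMeasurable U (volume.restrict (Ioi 0)))
    (hpos : ∀ᶠ x in 𝓝[>] (0 : ℝ), 0 < U x)
    (hreg : ∀ k : ℝ, 0 < k → Tendsto (fun x => U (k * x) / U x) (𝓝[>] 0) (𝓝 (k ^ ρ)))
    {η : ℝ} (hη : 0 < η) :
    ∃ δ > 0, (∀ x, 0 < x → x < δ → 0 < U x) ∧ ∀ x y : ℝ, 0 < x → x < δ → 0 < y → y * x < δ →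
      U (y * x) / U x ≤ exp η * (y ^ (ρ + η) + y ^ (ρ - η)) := by
  obtain ⟨δ₁, hδ₁, hball⟩ := mem_nhdsGT_iff_exists_Ioo_subset.1 hpos
  have hUpos : ∀ x, 0 < x → x < δ₁ → 0 < U x := fun x h1 h2 => hball ⟨h1, h2⟩
  have hmem : ∀ k : ℝ, 0 < k → ∀ᶠ x in 𝓝[>] (0 : ℝ), 0 < k * x ∧ k * x < δ₁ := by
    intro k hk
    filter_upwards [Ioo_mem_nhdsGT (show (0 : ℝ) < δ₁ / k from div_pos hδ₁ hk)] with x hx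
    exact ⟨mul_pos hk hx.1, by rw [mul_comm]; exact (lt_div_iff₀ hk).1 hx.2⟩
  have hmh : AEMeasurable (fun x => log (U x) - ρ * log x) (volume.restrict (Ioi 0)) :=
    hm.log.sub (by fun_prop)
  have hlim : ∀ k : ℝ, 0 < k → Tendsto (fun x => (log (U (k * x)) - ρ * log (k * x)) -
      (log (U x) - ρ * log x)) (𝓝[>] 0) (𝓝 0) := by
    intro k hk
    have h1 := ((hreg k hk).log (rpow_pos_of_pos hk ρ).ne').sub_const (ρ * log k)
    rw [log_rpow hk, sub_self] at h1
    refine h1.congr' ?_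
    filter_upwards [hmem k hk, hpos, self_mem_nhdsWithin] with x hx hx2 (hx3 : 0 < x)
    rw [log_div (hUpos _ hx.1 hx.2).ne' hx2.ne', log_mul hk.ne' hx3.ne']
    ring
  obtain ⟨δ₂, hδ₂, hP⟩ := exists_abs_sub_le_mul_log_of_slowlyVarying hmh hlim hη
  refine ⟨min δ₁ δ₂, lt_min hδ₁ hδ₂, fun x h1 h2 => hUpos x h1 (lt_min_iff.1 h2).1, ?_⟩
  intro x y hx hxδ hy hyx
  rw [lt_min_iff] at hxδ hyx
  have hyx0 := mul_pos hy hx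
  have hU1 := hUpos x hx hxδ.1
  have hU2 := hUpos _ hyx0 hyx.1
  have hb := (abs_le.1 (hP x (y * x) hx hxδ.2 hyx0 hyx.2)).2
  rw [mul_div_cancel_right₀ y hx.ne', log_mul hy.ne' hx.ne'] at hb
  have hlogle : log (U (y * x) / U x) ≤ η + (ρ * log y + η * |log y|) := by
    rw [log_div hU2.ne' hU1.ne']; linarith
  have hexp : ∀ a : ℝ, exp (log y * a) = y ^ a := fun a => (rpow_def_of_pos hy a).symm
  calc U (y * x) / U x ≤ exp (η + (ρ * log y + η * |log y|)) := by
        rw [← log_le_iff_le_exp (div_pos hU2 hU1)]; exact hlogle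
    _ = exp η * exp (ρ * log y + η * |log y|) := exp_add _ _
    _ ≤ exp η * (y ^ (ρ + η) + y ^ (ρ - η)) := by
        gcongr
        have p1 := rpow_pos_of_pos hy (ρ + η)
        have p2 := rpow_pos_of_pos hy (ρ - η)
        rcases abs_cases (log y) with h | h
        · rw [h.1, show ρ * log y + η * log y = log y * (ρ + η) by ring, hexp]
          linarith
        · rw [h.1, show ρ * log y + η * -log y = log y * (ρ - η) by ring, hexp]
          linarith

/-- Head of the Laplace transform of a function regularly varying at `0`. -/
theorem tendsto_laplace_head {U : ℝ → ℝ} {ρ η δ x₀ : ℝ}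
    (hm : AEMeasurable U (volume.restrict (Ioi 0))) (hη : 0 < η) (hηρ : -1 < ρ - η)
    (hδ : 0 < δ) (hUpos : ∀ x, 0 < x → x < δ → 0 < U x)
    (hP : ∀ x y : ℝ, 0 < x → x < δ → 0 < y → y * x < δ →
      U (y * x) / U x ≤ exp η * (y ^ (ρ + η) + y ^ (ρ - η)))
    (hreg : ∀ k : ℝ, 0 < k → Tendsto (fun x => U (k * x) / U x) (𝓝[>] 0) (𝓝 (k ^ ρ)))
    (hx₀ : 0 < x₀) (hx₀δ : x₀ < δ) :
    Tendsto (fun s : ℝ => (s * ∫ x in Ioc 0 x₀, exp (-s * x) * U x) / U (1 / s)) atTop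
      (𝓝 (Gamma (1 + ρ))) := by
  set g : ℝ → ℝ → ℝ := fun s => (Iic x₀).indicator fun x => exp (-s * x) * U x with hg
  have hinv : Tendsto (fun s : ℝ => 1 / s) atTop (𝓝[>] 0) := by
    simpa using tendsto_inv_atTop_nhdsGT_zero (𝕜 := ℝ)
  have hrew : ∀ s : ℝ, 0 < s → (s * ∫ x in Ioc 0 x₀, exp (-s * x) * U x) / U (1 / s) =
      ∫ y in Ioi 0, g s (y * (1 / s)) / U (1 / s) := by
    intro s hs
    rw [integral_div, integral_comp_mul_right_Ioi (g s) 0 (one_div_pos.2 hs), zero_mul, hg,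
      setIntegral_indicator measurableSet_Iic, Ioi_inter_Iic, smul_eq_mul, one_div, inv_inv]
  have hgamma : Gamma (1 + ρ) = ∫ y in Ioi 0, exp (-y) * y ^ ρ := by
    rw [Gamma_eq_integral (by linarith)]
    simp
  rw [hgamma]
  refine Tendsto.congr' (f₁ := fun s => ∫ y in Ioi 0, g s (y * (1 / s)) / U (1 / s)) ?_ ?_
  · filter_upwards [eventually_gt_atTop 0] with s hs using (hrew s hs).symm
  refine tendsto_integral_filter_of_dominated_convergence
    (fun y => exp η * (exp (-y) * y ^ (ρ + η) + exp (-y) * y ^ (ρ - η))) ?_ ?_ ?_ ?_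
  · filter_upwards [eventually_gt_atTop 0] with s hs
    have hgm : AEMeasurable (g s) (volume.restrict (Ioi 0)) :=
      AEMeasurable.indicator ((by fun_prop : AEMeasurable (fun x => exp (-s * x)) _).mul hm)
        measurableSet_Iic
    exact ((aemeasurable_comp_mul_right hgm (one_div_pos.2 hs)).div_const _).aestronglyMeasurable
  · filter_upwards [hinv.eventually (Ioo_mem_nhdsGT hδ), eventually_gt_atTop 0] with s hs hs0
    refine (ae_restrict_iff' measurableSet_Ioi).2 (ae_of_all _ fun y (hy : 0 < y) => ?_)
    have hU1 := hUpos _ hs.1 hs.2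
    have hbpos : 0 ≤ exp η * (exp (-y) * y ^ (ρ + η) + exp (-y) * y ^ (ρ - η)) := by positivity
    by_cases hyx : y * (1 / s) ≤ x₀
    · have hyx' : y * (1 / s) < δ := hyx.trans_lt hx₀δ
      have hU2 := hUpos _ (mul_pos hy hs.1) hyx'
      have hval : g s (y * (1 / s)) / U (1 / s) = exp (-y) * (U (y * (1 / s)) / U (1 / s)) := by
        rw [hg]
        simp only
        rw [indicator_of_mem (mem_Iic.2 hyx), show -s * (y * (1 / s)) = -y by field_simp]
        ring
      rw [hval, Real.norm_eq_abs, abs_of_nonneg (by positivity)]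
      calc exp (-y) * (U (y * (1 / s)) / U (1 / s))
          ≤ exp (-y) * (exp η * (y ^ (ρ + η) + y ^ (ρ - η))) := by
            gcongr
            exact hP _ _ hs.1 hs.2 hy hyx'
        _ = _ := by ring
    · rw [hg]
      simp only
      rw [indicator_of_notMem (by simpa using hyx)]
      simpa using hbpos
  · have h1 := GammaIntegral_convergent (s := ρ + η + 1) (by linarith)
    have h2 := GammaIntegral_convergent (s := ρ - η + 1) (by linarith)
    simp only [add_sub_cancel_right] at h1 h2
    exact (h1.add h2).const_mul _
  · refine (ae_restrict_iff' measurableSet_Ioi).2 (ae_of_all _ fun y (hy : 0 < y) => ?_)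
    refine (((hreg y hy).comp hinv).const_mul (exp (-y))).congr' ?_
    filter_upwards [eventually_gt_atTop 0, eventually_ge_atTop (y / x₀)] with s hs hs2
    have hyx : y * (1 / s) ≤ x₀ := by
      rw [mul_one_div, div_le_iff₀ hs]
      rwa [div_le_iff₀ hx₀, mul_comm] at hs2
    rw [hg]
    simp only [Function.comp]
    rw [indicator_of_mem (mem_Iic.2 hyx), show -s * (y * (1 / s)) = -y by field_simp]
    ring

/-- The tail of the Laplace transform is negligible against a regularly varying function. -/
theorem tendsto_laplace_tail {U : ℝ → ℝ} {ρ η δ x₀ : ℝ}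
    (hU0 : ∀ x : ℝ, 0 < x → 0 ≤ U x)
    (hconv : ∀ s : ℝ, 0 < s → IntegrableOn (fun x => exp (-s * x) * U x) (Ioi 0))
    (hδ : 0 < δ) (hUpos : ∀ x, 0 < x → x < δ → 0 < U x)
    (hP : ∀ x y : ℝ, 0 < x → x < δ → 0 < y → y * x < δ →
      U (y * x) / U x ≤ exp η * (y ^ (ρ + η) + y ^ (ρ - η)))
    (hx₀ : 0 < x₀) (hx₀δ : x₀ < δ) :
    Tendsto (fun s : ℝ => (s * ∫ x in Ioi x₀, exp (-s * x) * U x) / U (1 / s)) atTop (𝓝 0) := by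
  have hinv : Tendsto (fun s : ℝ => 1 / s) atTop (𝓝[>] 0) := by
    simpa using tendsto_inv_atTop_nhdsGT_zero (𝕜 := ℝ)
  set K := ∫ x in Ioi x₀, exp (-1 * x) * U x with hK
  have hint : ∀ s : ℝ, 0 < s → IntegrableOn (fun x => exp (-s * x) * U x) (Ioi x₀) :=
    fun s hs => (hconv s hs).mono_set (Ioi_subset_Ioi hx₀.le)
  have hnn : ∀ s : ℝ, 0 ≤ ∫ x in Ioi x₀, exp (-s * x) * U x := fun s =>
    setIntegral_nonneg measurableSet_Ioi fun x hx =>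
      mul_nonneg (exp_pos _).le (hU0 x (hx₀.trans hx))
  have htail : ∀ s : ℝ, 1 ≤ s →
      ∫ x in Ioi x₀, exp (-s * x) * U x ≤ exp (x₀ - x₀ * s) * K := by
    intro s hs
    rw [hK, ← integral_const_mul]
    refine setIntegral_mono_on (hint s (by linarith)) ((hint 1 one_pos).const_mul _)
      measurableSet_Ioi fun x (hx : x₀ < x) => ?_
    rw [← mul_assoc, ← exp_add]
    refine mul_le_mul_of_nonneg_right (exp_le_exp.2 ?_) (hU0 x (hx₀.trans hx))
    nlinarith
  have hx₀U := hUpos x₀ hx₀ hx₀δ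
  have hbound : ∀ᶠ s : ℝ in atTop, (s * ∫ x in Ioi x₀, exp (-s * x) * U x) / U (1 / s) ≤
      K * exp x₀ * exp η / (U x₀ * x₀) * ((x₀ * s) ^ (ρ + η + 1) * exp (-(x₀ * s)) +
        (x₀ * s) ^ (ρ - η + 1) * exp (-(x₀ * s))) := by
    filter_upwards [hinv.eventually (Ioo_mem_nhdsGT hδ), eventually_ge_atTop 1] with s hs hs1
    have hs0 : 0 < s := by linarith
    have hU1 := hUpos _ hs.1 hs.2
    have hxs : x₀ * s * (1 / s) = x₀ := by field_simp
    have hp := hP (1 / s) (x₀ * s) hs.1 hs.2 (by positivity) (by rwa [hxs])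
    rw [hxs] at hp
    have hp2 : 1 / U (1 / s) ≤
        exp η * ((x₀ * s) ^ (ρ + η) + (x₀ * s) ^ (ρ - η)) / U x₀ := by
      rw [le_div_iff₀ hx₀U]
      calc 1 / U (1 / s) * U x₀ = U x₀ / U (1 / s) := by ring
        _ ≤ _ := hp
    have hK0 : 0 ≤ K := hnn 1
    calc (s * ∫ x in Ioi x₀, exp (-s * x) * U x) / U (1 / s)
        = (s * ∫ x in Ioi x₀, exp (-s * x) * U x) * (1 / U (1 / s)) := by ring
      _ ≤ (s * (exp (x₀ - x₀ * s) * K)) *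
          (exp η * ((x₀ * s) ^ (ρ + η) + (x₀ * s) ^ (ρ - η)) / U x₀) := by
        gcongr
        exact htail s hs1
      _ = _ := by
        rw [rpow_add_one (by positivity), rpow_add_one (by positivity), sub_eq_add_neg, exp_add]
        field_simp
  have hlin : Tendsto (fun s : ℝ => x₀ * s) atTop atTop := tendsto_id.const_mul_atTop hx₀
  have hdec : ∀ a : ℝ, Tendsto (fun s : ℝ => (x₀ * s) ^ a * exp (-(x₀ * s))) atTop (𝓝 0) := by
    intro a
    have := (tendsto_rpow_mul_exp_neg_mul_atTop_nhds_zero a 1 one_pos).comp hlin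
    simpa [Function.comp_def] using this
  refine tendsto_of_tendsto_of_tendsto_of_le_of_le' tendsto_const_nhds ?_ ?_ hbound
  · simpa using ((hdec (ρ + η + 1)).add (hdec (ρ - η + 1))).const_mul
      (K * exp x₀ * exp η / (U x₀ * x₀))
  · filter_upwards [hinv.eventually (Ioo_mem_nhdsGT hδ), eventually_gt_atTop 0] with s hs hs0
    exact div_nonneg (mul_nonneg hs0.le (hnn s)) (hUpos _ hs.1 hs.2).le

/-- Abelian theorem for the Laplace transform of a function regularly varying at `0`. -/
theorem tendsto_laplace_div_of_regularlyVarying {U : ℝ → ℝ} {ρ : ℝ} (hρ : -1 < ρ)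
    (hU0 : ∀ x : ℝ, 0 < x → 0 ≤ U x)
    (hconv : ∀ s : ℝ, 0 < s → IntegrableOn (fun x => exp (-s * x) * U x) (Ioi 0))
    (hpos : ∀ᶠ x in 𝓝[>] (0 : ℝ), 0 < U x)
    (hreg : ∀ k : ℝ, 0 < k → Tendsto (fun x => U (k * x) / U x) (𝓝[>] 0) (𝓝 (k ^ ρ))) :
    Tendsto (fun s : ℝ => (s * ∫ x in Ioi 0, exp (-s * x) * U x) / U (1 / s)) atTop
      (𝓝 (Gamma (1 + ρ))) := by
  have hm : AEMeasurable U (volume.restrict (Ioi 0)) := by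
    have h1 : AEMeasurable (fun x => exp x * (exp (-1 * x) * U x)) (volume.restrict (Ioi 0)) :=
      (by fun_prop : AEMeasurable (fun x : ℝ => exp x) _).mul (hconv 1 one_pos).aemeasurable
    convert h1 using 2 with x
    rw [← mul_assoc, ← exp_add]
    simp
  obtain ⟨η, hη, hηρ⟩ : ∃ η : ℝ, 0 < η ∧ -1 < ρ - η := ⟨(ρ + 1) / 2, by linarith, by linarith⟩
  obtain ⟨δ, hδ, hUpos, hP⟩ := potter_bound_of_regularlyVarying hm hpos hreg hη
  have hx₀ : 0 < δ / 2 := half_pos hδ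
  have hx₀δ : δ / 2 < δ := half_lt_self hδ
  have hsum := (tendsto_laplace_head hm hη hηρ hδ hUpos hP hreg hx₀ hx₀δ).add
    (tendsto_laplace_tail hU0 hconv hδ hUpos hP hx₀ hx₀δ)
  rw [add_zero] at hsum
  refine hsum.congr' ?_
  filter_upwards [eventually_gt_atTop 0] with s hs
  rw [← add_div, ← mul_add, ← setIntegral_union Ioc_disjoint_Ioi_same measurableSet_Ioi
    ((hconv s hs).mono_set Ioc_subset_Ioi_self)
    ((hconv s hs).mono_set (Ioi_subset_Ioi hx₀.le)), Ioc_union_Ioi_eq_Ioi hx₀.le]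

theorem stmt_19 (U ℓ : ℝ → ℝ) (c ρ : ℝ) (hc : 0 ≤ c) (hρ : -1 < ρ)
    (hU0 : ∀ x : ℝ, 0 < x → 0 ≤ U x)
    (hℓpos : ∀ x : ℝ, 0 < x → 0 < ℓ x)
    (hℓ : SlowlyVaryingAtTop ℓ)
    (hconv : ∀ s : ℝ, 0 < s →
      MeasureTheory.IntegrableOn (fun x => Real.exp (-s * x) * U x) (Set.Ioi 0))
    (hasymp : Filter.Tendsto
      (fun x : ℝ => U x / (c * x ^ ρ * ℓ (1 / x) / Real.Gamma (1 + ρ)))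
      (nhdsWithin 0 (Set.Ioi 0)) (nhds 1)) :
    Filter.Tendsto
      (fun s : ℝ =>
        (s * ∫ x in Set.Ioi (0 : ℝ), Real.exp (-s * x) * U x) / (c * s ^ (-ρ) * ℓ s))
      Filter.atTop (nhds 1) := by
  have hΓ : 0 < Gamma (1 + ρ) := Gamma_pos_of_pos (by linarith)
  have hc' : 0 < c := by
    refine hc.lt_of_ne fun h0 => ?_
    simp only [← h0, zero_mul, zero_div, div_zero] at hasymp
    exact zero_ne_one (tendsto_nhds_unique tendsto_const_nhds hasymp)
  set V : ℝ → ℝ := fun x => c * x ^ ρ * ℓ (1 / x) / Gamma (1 + ρ) with hV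
  have hVpos : ∀ x, 0 < x → 0 < V x := fun x hx => by
    have := hℓpos (1 / x) (one_div_pos.2 hx)
    have := rpow_pos_of_pos hx ρ
    simp only [hV]
    positivity
  have hpos : ∀ᶠ x in 𝓝[>] (0 : ℝ), 0 < U x := by
    filter_upwards [hasymp.eventually (lt_mem_nhds one_pos), self_mem_nhdsWithin]
      with x hx (hx0 : 0 < x)
    exact (div_pos_iff_of_pos_right (hVpos x hx0)).1 hx
  have hinv : Tendsto (fun s : ℝ => 1 / s) atTop (𝓝[>] 0) := by
    simpa using tendsto_inv_atTop_nhdsGT_zero (𝕜 := ℝ)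
  have hinv0 : Tendsto (fun x : ℝ => 1 / x) (𝓝[>] 0) atTop := by
    simpa using tendsto_inv_nhdsGT_zero (𝕜 := ℝ)
  have hscale : ∀ k : ℝ, 0 < k → Tendsto (fun x : ℝ => k * x) (𝓝[>] 0) (𝓝[>] 0) := by
    intro k hk
    refine tendsto_nhdsWithin_iff.2 ⟨?_, ?_⟩
    · simpa using (tendsto_id.const_mul k).mono_left (nhdsWithin_le_nhds (a := (0 : ℝ)))
    · filter_upwards [self_mem_nhdsWithin] with x hx using mul_pos hk hx
  have hVreg : ∀ k : ℝ, 0 < k → Tendsto (fun x => V (k * x) / V x) (𝓝[>] 0) (𝓝 (k ^ ρ)) := by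
    intro k hk
    have h1 := ((hℓ k⁻¹ (inv_pos.2 hk)).comp hinv0).const_mul (k ^ ρ)
    rw [mul_one] at h1
    refine h1.congr' ?_
    filter_upwards [self_mem_nhdsWithin] with x (hx : 0 < x)
    have := hℓpos (1 / x) (one_div_pos.2 hx)
    have := rpow_pos_of_pos hx ρ
    simp only [hV, Function.comp]
    rw [mul_rpow hk.le hx.le, show k⁻¹ * (1 / x) = 1 / (k * x) by field_simp]
    field_simp
  have hreg : ∀ k : ℝ, 0 < k → Tendsto (fun x => U (k * x) / U x) (𝓝[>] 0) (𝓝 (k ^ ρ)) := by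
    intro k hk
    have h1 := ((hasymp.comp (hscale k hk)).div hasymp one_ne_zero).mul (hVreg k hk)
    rw [div_one, one_mul] at h1
    refine h1.congr' ?_
    filter_upwards [self_mem_nhdsWithin, hpos] with x (hx : 0 < x) hUx
    have h2 := hVpos x hx
    have h3 := hVpos (k * x) (mul_pos hk hx)
    change U (k * x) / V (k * x) / (U x / V x) * (V (k * x) / V x) = U (k * x) / U x
    field_simp
  have hmain := ((tendsto_laplace_div_of_regularlyVarying hρ hU0 hconv hpos hreg).mul
    (hasymp.comp hinv)).div_const (Gamma (1 + ρ))
  rw [mul_one, div_self hΓ.ne'] at hmain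
  refine hmain.congr' ?_
  filter_upwards [eventually_gt_atTop 0, hinv.eventually hpos] with s hs hUs
  have h1 := hℓpos s hs
  have h2 := rpow_pos_of_pos hs (-ρ)
  have hVs : V (1 / s) = c * s ^ (-ρ) * ℓ s / Gamma (1 + ρ) := by
    simp only [hV]
    rw [one_div_one_div, one_div, inv_rpow hs.le, rpow_neg hs.le]
  change _ / U (1 / s) * (U (1 / s) / V (1 / s)) / Gamma (1 + ρ) = _
  rw [hVs]
  field_simp
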